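/- For every n : ℕ, the number of β-normal forms of natural size n equals the sum over k ≤ n of the numbers of neutral λ-terms of size k: Nat.card {t : Term // Normal t ∧ size t = n} = ∑_{k=0}^{n} Nat.card {t : Term // Neutral t ∧ size t = k}. (This is the counting form of the generating-function identity N(z) = M(z)/(1−z).) -/

import Mathlib

inductive Term : Type
  | idx : ℕ → Term
  | app : Term → Term → Term
  | abs : Term → Term

def Term.size : Term → ℕ
  | .idx n => n + 1
  | .app t u => t.size + u.size + 1
  | .abs t => t.size + 1

namespace Lambda

mutual
  inductive Neutral : Term → Prop
    | idx (n : ℕ) : Neutral (.idx n)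
    | app {t u : Term} : Neutral t → Normal u → Neutral (.app t u)
  inductive Normal : Term → Prop
    | of {t : Term} : Neutral t → Normal t
    | abs {t : Term} : Normal t → Normal (.abs t)
end

theorem finite_size_le (n : ℕ) : {t : Term | t.size ≤ n}.Finite := by
  induction n with
  | zero =>
    refine Set.finite_empty.subset ?_
    rintro (_ | _ | _) h <;> simp [Term.size] at h
  | succ n ih =>
    refine (((Set.finite_Iic n).image Term.idx).union
      ((ih.image2 Term.app ih).union (ih.image Term.abs))).subset ?_
    rintro (i | ⟨t, u⟩ | t) h <;> simp only [Set.mem_ofPred_eq, Term.size] at h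
    · exact Or.inl ⟨i, by simpa using h, rfl⟩
    · exact Or.inr (Or.inl ⟨t, by simp; omega, u, by simp; omega, rfl⟩)
    · exact Or.inr (Or.inr ⟨t, by simp; omega, rfl⟩)

theorem finite_size_eq (p : Term → Prop) (n : ℕ) : {t : Term | p t ∧ t.size = n}.Finite :=
  (finite_size_le n).subset fun _ h => h.2.le

theorem size_pos (t : Term) : 0 < t.size := by
  cases t <;> simp [Term.size]

theorem not_neutral_abs (t : Term) : ¬ Neutral (.abs t) := nofun

theorem normal_size_succ (n : ℕ) :
    {t : Term | Normal t ∧ t.size = n + 1} =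
      {t | Neutral t ∧ t.size = n + 1} ∪ Term.abs '' {t | Normal t ∧ t.size = n} := by
  ext t
  constructor
  · rintro ⟨h | h, hs⟩
    · exact Or.inl ⟨h, hs⟩
    · exact Or.inr ⟨_, ⟨h, Nat.succ_injective hs⟩, rfl⟩
  · rintro (⟨h, hs⟩ | ⟨u, ⟨h, hs⟩, rfl⟩)
    · exact ⟨.of h, hs⟩
    · exact ⟨.abs h, congrArg (· + 1) hs⟩

theorem card_normal_size_succ (n : ℕ) :
    Nat.card {t : Term // Normal t ∧ t.size = n + 1} =
      Nat.card {t : Term // Normal t ∧ t.size = n} +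
        Nat.card {t : Term // Neutral t ∧ t.size = n + 1} := by
  change {t : Term | Normal t ∧ t.size = n + 1}.ncard =
    {t : Term | Normal t ∧ t.size = n}.ncard + {t : Term | Neutral t ∧ t.size = n + 1}.ncard
  have disj : Disjoint {t : Term | Neutral t ∧ t.size = n + 1}
      (Term.abs '' {t | Normal t ∧ t.size = n}) := by
    rw [Set.disjoint_left]
    rintro _ ⟨h, -⟩ ⟨u, -, rfl⟩
    exact not_neutral_abs u h
  rw [normal_size_succ, Set.ncard_union_eq disj (finite_size_eq _ _)
    ((finite_size_eq _ _).image _), Set.ncard_image_of_injective _ fun _ _ h => Term.abs.inj h,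
    add_comm]

theorem card_size_zero (p : Term → Prop) : Nat.card {t : Term // p t ∧ t.size = 0} = 0 := by
  have : IsEmpty {t : Term // p t ∧ t.size = 0} := ⟨fun t => (size_pos t.1).ne' t.2.2⟩
  exact Nat.card_of_isEmpty

theorem normal_eq_sum_neutral :
    ∀ n : ℕ, Nat.card {t : Term // Normal t ∧ t.size = n}
      = ∑ k ∈ Finset.range (n + 1), Nat.card {t : Term // Neutral t ∧ t.size = k} := by
  intro n
  induction n with
  | zero => simp only [zero_add, Finset.sum_range_one, card_size_zero]
  | succ n ih => rw [card_normal_size_succ, ih, Finset.sum_range_succ _ (n + 1)]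

end Lambda
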